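/- The cardinality of the abacus blob monoid 𝔅l_{d,n} equals d^n · Σ_{k=0}^{n} Ω_k^{(n)} d^k. -/

import Mathlib

open Finset

/-- `l` encodes a (non-degenerate) indexing matrix on `n` points: the columns,
listed left to right, as pairs `(top entry, bottom entry)`.  Entries lie in
`[0, n-1]`, the first row is strictly increasing, the second row is weakly
increasing, repeated second-row entries are `0`, and each top entry is at
least the corresponding bottom entry. -/
def IsIndexingMatrix (n : ℕ) (l : List (ℕ × ℕ)) : Prop :=
  1 ≤ l.length ∧ l.length ≤ n ∧
  (∀ p ∈ l, p.1 < n ∧ p.2 ≤ p.1) ∧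
  l.Pairwise (fun p q => p.1 < q.1 ∧ p.2 ≤ q.2 ∧ (p.2 = q.2 → p.2 = 0))

/-- A positive indexing matrix: all entries are positive. -/
def IsPositiveIndexingMatrix (n : ℕ) (l : List (ℕ × ℕ)) : Prop :=
  IsIndexingMatrix n l ∧ ∀ p ∈ l, 0 < p.1 ∧ 0 < p.2

/-- `θ_k^{(n)}`: the number of positive indexing matrices whose `(1,1)` entry
equals `k`. -/
noncomputable def theta (n k : ℕ) : ℕ :=
  Nat.card {l : List (ℕ × ℕ) //
    IsPositiveIndexingMatrix n l ∧ l.head?.map Prod.fst = some k}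

/-- The blob-rank of an indexing matrix: the number of its columns containing
a `0`. -/
def blobRank (l : List (ℕ × ℕ)) : ℕ := l.countP (fun p => p.1 == 0 || p.2 == 0)

/-- `Ω_r^{(n)}`: the number of indexing matrices on `n` points of blob-rank `r`,
the degenerate indexing matrix being counted in `Ω_0^{(n)}`. -/
noncomputable def Omega (n r : ℕ) : ℕ :=
  Nat.card {l : List (ℕ × ℕ) // IsIndexingMatrix n l ∧ blobRank l = r} +
    (if r = 0 then 1 else 0)

/-- `χ_k^{(n)} = Σ_{i₁+⋯+i_k = n-k} C_{i₁} ⋯ C_{i_k}` (Catalan numbers). -/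
def chi (n k : ℕ) : ℕ :=
  ∑ t ∈ Finset.Nat.antidiagonalTuple k (n - k), ∏ j, catalan (t j)

/-- A Temperley–Lieb diagram on `n` points: a non-crossing perfect matching of
`2n` boundary points numbered clockwise, given by a fixed-point free
involution. -/
structure TLDiagram (n : ℕ) where
  f : Fin (2 * n) → Fin (2 * n)
  involutive : ∀ x, f (f x) = x
  noFixedPoint : ∀ x, f x ≠ x
  noncrossing : ∀ a b : Fin (2 * n), a < b → b < f a → f a < f b → False

/-- `a` is the left (smaller) endpoint of an arc of `D`. -/
def TLDiagram.IsArc {n : ℕ} (D : TLDiagram n) (a : Fin (2 * n)) : Prop :=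
  a < D.f a

/-- The arc with left endpoint `a` is exposed to the left side of the diagram,
i.e. it is not nested inside any other arc. -/
def TLDiagram.IsExposed {n : ℕ} (D : TLDiagram n) (a : Fin (2 * n)) : Prop :=
  a < D.f a ∧ ∀ c, ¬ (c < a ∧ D.f a < D.f c)

/-- The number of arcs of `D` exposed to the left side. -/
noncomputable def exposedCount {n : ℕ} (D : TLDiagram n) : ℕ :=
  Nat.card {a : Fin (2 * n) // D.IsExposed a}

/-- A `d`-abacus blob diagram on `n` points: a TL-diagram together with blobs
on some arcs exposed to the left, one bead count in `ℤ/dℤ` on every arc, and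
an extra bead count on every blobbed arc (its second component). -/
structure AbacusBlobDiagram (d n : ℕ) where
  base : TLDiagram n
  blob : Fin (2 * n) → Bool
  blob_exposed : ∀ a, blob a = true → base.IsExposed a
  beads₁ : Fin (2 * n) → ZMod d
  beads₂ : Fin (2 * n) → ZMod d
  beads₁_arc : ∀ a, ¬ base.IsArc a → beads₁ a = 0
  beads₂_blob : ∀ a, blob a = false → beads₂ a = 0

/-- A `d`-abacus hook diagram on `n` points: a blobbed TL-diagram in which all
blobbed arcs are merged into the single hook component through `0, 0'`, with a
bead count in `ℤ/dℤ` on every unblobbed arc and one on the hook component. -/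
structure AbacusHookDiagram (d n : ℕ) where
  base : TLDiagram n
  blob : Fin (2 * n) → Bool
  blob_exposed : ∀ a, blob a = true → base.IsExposed a
  beads : Fin (2 * n) → ZMod d
  beads_arc : ∀ a, ¬ base.IsArc a ∨ blob a = true → beads a = 0
  hookBeads : ZMod d

/-! ### Numeric part -/

/-- weights of prefixes counted by returns -/
theorem returns_closed (y : ℤ) (h : ℕ → ℕ → ℤ) (h0 : ∀ m, h m 0 = 1)
    (hd : ∀ m, h (m + 1) (m + 1) = y * h (m + 1) m)
    (hr : ∀ m j, j + 1 ≤ m → h (m + 1) (j + 1) = h m (j + 1) + h (m + 1) j) :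
    ∀ m j, j ≤ m + 1 → h (m + 1) j =
      ∑ s ∈ range (j + 1), y ^ (j - s) * (((m + s).choose m : ℤ) - ((m + s).choose (m + 1) : ℤ)) := by
  have shift : ∀ m j, ∑ s ∈ range (j + 1 + 1), y ^ (j + 1 - s) *
      (((m + s).choose m : ℤ) - ((m + s).choose (m + 1) : ℤ)) =
      y * ∑ s ∈ range (j + 1), y ^ (j - s) *
        (((m + s).choose m : ℤ) - ((m + s).choose (m + 1) : ℤ)) +
      (((m + (j + 1)).choose m : ℤ) - ((m + (j + 1)).choose (m + 1) : ℤ)) := by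
    intro m j
    rw [Finset.sum_range_succ, Finset.mul_sum]
    congr 1
    · apply Finset.sum_congr rfl
      intro s hs
      have : s ≤ j := by simpa [Nat.lt_succ_iff] using hs
      rw [show j + 1 - s = (j - s) + 1 by omega, pow_succ]; ring
    · simp
  intro m
  induction m with
  | zero =>
    intro j hj
    interval_cases j
    · simp [h0]
    · rw [hd 0, h0]; simp [Finset.sum_range_succ]
  | succ m ih =>
    intro j
    induction j with
    | zero => intro _; simp [h0]
    | succ j ihj =>
      intro hj
      rcases Nat.lt_or_ge j (m + 1) with hlt | hge
      · rw [hr (m + 1) j (by omega), ih (j + 1) (by omega), ihj (by omega)]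
        rw [Finset.sum_range_succ' _ (j + 1), Finset.sum_range_succ' _ (j + 1)]
        have : ∀ s ∈ range (j + 1), y ^ (j + 1 - (s + 1)) *
            (((m + 1 + (s + 1)).choose (m + 1) : ℤ) - ((m + 1 + (s + 1)).choose (m + 1 + 1) : ℤ)) =
            y ^ (j + 1 - (s + 1)) *
            (((m + (s + 1)).choose m : ℤ) - ((m + (s + 1)).choose (m + 1) : ℤ)) +
            y ^ (j - s) *
            (((m + 1 + s).choose (m + 1) : ℤ) - ((m + 1 + s).choose (m + 1 + 1) : ℤ)) := by
          intro s hs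
          rw [show m + 1 + (s + 1) = (m + (s + 1)) + 1 by ring,
            show m + 1 + s = m + (s + 1) by ring,
            Nat.choose_succ_succ, Nat.choose_succ_succ _ (m + 1)]
          rw [show j + 1 - (s + 1) = j - s by omega]
          push_cast; ring
        rw [Finset.sum_congr rfl this, Finset.sum_add_distrib]
        simp; ring
      · obtain rfl : j = m + 1 := by omega
        rw [hd (m + 1), ihj (by omega), shift _ (m + 1)]
        have := Nat.choose_symm_of_eq_add (n := m + 1 + (m + 1 + 1)) (a := m + 1)
          (b := m + 1 + 1) (by ring)
        rw [this]; ring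

theorem initial_closed (y : ℤ) (W : ℕ → ℕ → ℤ) (h0 : ∀ m, W m 0 = y ^ m)
    (hd : ∀ m, W (m + 1) (m + 1) = W (m + 1) m)
    (hr : ∀ m j, j + 1 ≤ m → W (m + 1) (j + 1) = W m (j + 1) + W (m + 1) j) :
    ∀ m j, j + 1 ≤ m → W m (j + 1) =
      ∑ t ∈ range (m + 1), y ^ (m - t) * (((t + j).choose j : ℤ) - ((t + j).choose m : ℤ)) := by
  -- the closed form
  set F : ℕ → ℕ → ℤ := fun m j =>
    ∑ t ∈ range (m + 1), y ^ (m - t) * (((t + j).choose j : ℤ) - ((t + j).choose m : ℤ)) with hF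
  have Fdiag : ∀ m, F m m = 0 := by
    intro m; simp [hF]
  have F0 : ∀ m, F (m + 1) 0 = F m 0 + y ^ (m + 1) := by
    intro m
    simp only [hF]
    rw [Finset.sum_range_succ', Finset.sum_range_succ (n := m), Finset.sum_range_succ (n := m)]
    have e1 : ∀ t ∈ range m, y ^ (m + 1 - (t + 1)) * (((t + 1 + 0).choose 0 : ℤ) - ((t + 1 + 0).choose (m + 1) : ℤ)) = y ^ (m - t) := by
      intro t ht
      have : t < m := by simpa using ht
      rw [Nat.choose_eq_zero_of_lt (n := t + 1 + 0) (k := m + 1) (by omega)]; simp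
    have e2 : ∀ t ∈ range m, y ^ (m - t) * (((t + 0).choose 0 : ℤ) - ((t + 0).choose m : ℤ)) = y ^ (m - t) := by
      intro t ht
      have : t < m := by simpa using ht
      rw [Nat.choose_eq_zero_of_lt (n := t + 0) (k := m) (by omega)]; simp
    rw [Finset.sum_congr rfl e1, Finset.sum_congr rfl e2]
    simp
  have Fr : ∀ m j, j + 1 ≤ m → F (m + 1) (j + 1) = F m (j + 1) + F (m + 1) j := by
    intro m j hj
    simp only [hF]
    rw [Finset.sum_range_succ' _ (m + 1), Finset.sum_range_succ' _ (m + 1)]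
    have : ∀ t ∈ range (m + 1), y ^ (m + 1 - (t + 1)) *
        (((t + 1 + (j + 1)).choose (j + 1) : ℤ) - ((t + 1 + (j + 1)).choose (m + 1) : ℤ)) =
        y ^ (m - t) * (((t + (j + 1)).choose (j + 1) : ℤ) - ((t + (j + 1)).choose m : ℤ)) +
        y ^ (m + 1 - (t + 1)) * (((t + 1 + j).choose j : ℤ) - ((t + 1 + j).choose (m + 1) : ℤ)) := by
      intro t _
      rw [show t + 1 + (j + 1) = (t + 1 + j) + 1 by ring,
        show t + (j + 1) = t + 1 + j by ring,
        Nat.choose_succ_succ, Nat.choose_succ_succ _ m]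
      rw [show m + 1 - (t + 1) = m - t by omega]
      push_cast; ring
    rw [Finset.sum_congr rfl this, Finset.sum_add_distrib]
    have a1 : (0 + (j + 1)).choose (m + 1) = 0 := Nat.choose_eq_zero_of_lt (by omega)
    have a2 : (0 + j).choose (m + 1) = 0 := Nat.choose_eq_zero_of_lt (by omega)
    rw [a1, a2]; simp; ring
  change ∀ m j, j + 1 ≤ m → W m (j + 1) = F m j
  intro m
  induction m with
  | zero => intro j hj; omega
  | succ m ih =>
    intro j
    induction j with
    | zero =>
      intro _
      rcases Nat.eq_zero_or_pos m with rfl | hm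
      · rw [hd 0, h0, F0, Fdiag]; simp
      · rw [hr m 0 (by omega), ih 0 (by omega), h0, F0]
    | succ j ihj =>
      intro hj
      rcases Nat.lt_or_ge (j + 1) m with hlt | hge
      · rw [hr m (j + 1) (by omega), ih (j + 1) (by omega), ihj (by omega), Fr m j (by omega)]
      · obtain rfl : m = j + 1 := by omega
        rw [hd (j + 1), ihj (by omega), Fr (j + 1) j (by omega), Fdiag]; simp

theorem closed_agree (y : ℤ) (h W : ℕ → ℕ → ℤ) (h0 : ∀ m, h m 0 = 1)
    (hd : ∀ m, h (m + 1) (m + 1) = y * h (m + 1) m)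
    (hr : ∀ m j, j + 1 ≤ m → h (m + 1) (j + 1) = h m (j + 1) + h (m + 1) j)
    (w0 : ∀ m, W m 0 = y ^ m)
    (wd : ∀ m, W (m + 1) (m + 1) = W (m + 1) m)
    (wr : ∀ m j, j + 1 ≤ m → W (m + 1) (j + 1) = W m (j + 1) + W (m + 1) j) (n : ℕ) :
    h (n + 1) (n + 1) = W (n + 1) (n + 1) := by
  rw [returns_closed y h h0 hd hr n (n + 1) le_rfl, initial_closed y W w0 wd wr (n + 1) n le_rfl]
  apply Finset.sum_congr rfl
  intro s _
  rw [add_comm n s]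

/-! ### Indexing matrices -/

/-- Indexing matrices with tops `< m` and bottoms `≤ j`, the empty one included. -/
def IMat : ℕ → ℕ → Finset (List (ℕ × ℕ))
  | 0, _ => {[]}
  | m + 1, j => IMat m j ∪
      (range (min j m + 1)).biUnion (fun b => (IMat m (b - 1)).image (fun l => l ++ [(m, b)]))

theorem mem_IMat (m : ℕ) : ∀ (j : ℕ) (l : List (ℕ × ℕ)), l ∈ IMat m j ↔
    (∀ p ∈ l, p.1 < m ∧ p.2 ≤ p.1 ∧ p.2 ≤ j) ∧
    l.Pairwise (fun p q => p.1 < q.1 ∧ p.2 ≤ q.2 ∧ (p.2 = q.2 → p.2 = 0)) := by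
  induction m with
  | zero =>
    intro j l
    simp only [IMat, mem_singleton]
    constructor
    · rintro rfl; simp
    · rintro ⟨h, _⟩
      cases l with
      | nil => rfl
      | cons a t => exact absurd (h a (by simp)).1 (by omega)
  | succ m ih =>
    intro j l
    simp only [IMat, mem_union, mem_biUnion, mem_image, mem_range]
    constructor
    · rintro (h | ⟨b, hb, l', hl', rfl⟩)
      · rw [ih] at h
        exact ⟨fun p hp => ⟨by have := (h.1 p hp).1; omega, (h.1 p hp).2⟩, h.2⟩
      · rw [ih] at hl'
        constructor
        · intro p hp
          rw [List.mem_append, List.mem_singleton] at hp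
          rcases hp with hp | rfl
          · have := hl'.1 p hp; omega
          · simp only; omega
        · rw [List.pairwise_append]
          refine ⟨hl'.2, by simp, ?_⟩
          intro p hp q hq
          rw [List.mem_singleton] at hq
          subst hq
          have := hl'.1 p hp
          simp only; omega
    · rintro ⟨h1, h2⟩
      rcases List.eq_nil_or_concat l with rfl | ⟨l', ⟨a, b⟩, rfl⟩
      · left; rw [ih]; simp
      · rw [List.concat_eq_append] at *
        rw [List.pairwise_append] at h2
        have hab := h1 (a, b) (by simp)
        have hl' : ∀ p ∈ l', p.1 < a ∧ p.2 ≤ b ∧ (p.2 = b → p.2 = 0) :=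
          fun p hp => h2.2.2 p hp (a, b) (by simp)
        simp only at hab
        rcases Nat.lt_or_ge a m with ha | ha
        · left; rw [ih]
          refine ⟨?_, by rw [List.pairwise_append]; exact h2⟩
          intro p hp
          have h3 := h1 p hp
          rw [List.mem_append, List.mem_singleton] at hp
          rcases hp with hp | rfl
          · have := hl' p hp; omega
          · simp only at *; omega
        · obtain rfl : a = m := by omega
          right
          refine ⟨b, by omega, l', ?_, rfl⟩
          rw [ih]
          refine ⟨?_, h2.1⟩
          intro p hp
          have h3 := h1 p (by simp [hp])
          have := hl' p hp
          omega

/-- weighted count -/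
def IW (d m j : ℕ) : ℕ := ∑ l ∈ IMat m j, d ^ blobRank l

theorem blobRank_append (l : List (ℕ × ℕ)) (m b : ℕ) (hb : b ≤ m) :
    blobRank (l ++ [(m, b)]) = blobRank l + if b = 0 then 1 else 0 := by
  unfold blobRank
  rw [List.countP_append]
  by_cases h : b = 0
  · simp [h]
  · have : m ≠ 0 := by omega
    simp [h, this]

theorem IW_zero (d j : ℕ) : IW d 0 j = 1 := by simp [IW, IMat, blobRank]

theorem IW_succ (d m j : ℕ) : IW d (m + 1) j = IW d m j +
    ∑ b ∈ range (min j m + 1), (if b = 0 then d else 1) * IW d m (b - 1) := by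
  unfold IW
  rw [IMat, Finset.sum_union, Finset.sum_biUnion]
  · congr 1
    apply Finset.sum_congr rfl
    intro b hb
    rw [mem_range] at hb
    rw [Finset.sum_image, Finset.mul_sum]
    · apply Finset.sum_congr rfl
      intro l _
      rw [blobRank_append _ _ _ (by omega)]
      split_ifs <;> simp [pow_succ, mul_comm]
    · intro x _ y _ h
      simpa using h
  · intro b _ c _ hbc
    simp only [Function.onFun]
    rw [Finset.disjoint_left]
    intro l h1 h2
    simp only [mem_image] at h1 h2
    obtain ⟨x, _, rfl⟩ := h1
    obtain ⟨y, _, h⟩ := h2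
    have := List.append_inj_right' h rfl
    simp at this
    exact hbc this.symm
  · rw [Finset.disjoint_left]
    intro l h1 h2
    simp only [mem_biUnion, mem_image] at h2
    obtain ⟨b, _, x, _, rfl⟩ := h2
    rw [mem_IMat] at h1
    have := (h1.1 (m, b) (by simp)).1
    simp at this

theorem IW_col_zero (d m : ℕ) : IW d m 0 = (d + 1) ^ m := by
  induction m with
  | zero => simp [IW_zero]
  | succ m ih => rw [IW_succ]; simp [ih]; ring

theorem IW_const (d m : ℕ) : ∀ j, m ≤ j + 1 → IW d m (j + 1) = IW d m j := by
  induction m with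
  | zero => intro j _; simp [IW_zero]
  | succ m ih =>
    intro j hj
    rw [IW_succ, IW_succ, ih j (by omega), min_eq_right (by omega), min_eq_right (by omega)]

theorem IW_rec (d m j : ℕ) (hj : j + 1 ≤ m) :
    IW d (m + 1) (j + 1) = IW d m (j + 1) + IW d (m + 1) j := by
  rw [IW_succ d m (j + 1), IW_succ d m j, min_eq_left (by omega), min_eq_left (by omega),
    Finset.sum_range_succ _ (j + 1)]
  simp; ring

theorem length_le_of_tops (n : ℕ) (l : List (ℕ × ℕ)) (h1 : ∀ p ∈ l, p.1 < n)
    (h2 : l.Pairwise (fun p q => p.1 < q.1)) : l.length ≤ n := by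
  have hnd : (l.map Prod.fst).Nodup := by
    rw [List.Nodup, List.pairwise_map]
    exact h2.imp (fun h => Nat.ne_of_lt h)
  have := List.toFinset_card_of_nodup hnd
  rw [List.length_map] at this
  rw [← this]
  calc _ ≤ (range n).card := Finset.card_le_card (by
        intro x hx
        simp only [List.mem_toFinset, List.mem_map] at hx
        obtain ⟨p, hp, rfl⟩ := hx
        simpa using h1 p hp)
    _ = n := by simp

theorem isIndexing_iff (n : ℕ) (l : List (ℕ × ℕ)) :
    IsIndexingMatrix n l ↔ l ∈ IMat n n ∧ l ≠ [] := by
  rw [mem_IMat]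
  constructor
  · rintro ⟨h1, h2, h3, h4⟩
    refine ⟨⟨fun p hp => ?_, h4⟩, ?_⟩
    · have := h3 p hp; omega
    · rintro rfl; simp at h1
  · rintro ⟨⟨h1, h2⟩, h3⟩
    refine ⟨List.length_pos_iff.2 h3, ?_, fun p hp => ⟨(h1 p hp).1, (h1 p hp).2.1⟩, h2⟩
    exact length_le_of_tops n l (fun p hp => (h1 p hp).1) (h2.imp (fun h => h.1))

theorem Omega_eq (n r : ℕ) : Omega n r = ((IMat n n).filter (fun l => blobRank l = r)).card := by
  have hnil : ([] : List (ℕ × ℕ)) ∈ IMat n n := by rw [mem_IMat]; simp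
  have e : Nat.card {l : List (ℕ × ℕ) // IsIndexingMatrix n l ∧ blobRank l = r} =
      (((IMat n n).filter (fun l => blobRank l = r)).erase []).card := by
    rw [← Nat.card_eq_finsetCard]
    apply Nat.card_congr
    apply Equiv.subtypeEquivRight
    intro l
    rw [isIndexing_iff]
    simp only [mem_erase, mem_filter]
    tauto
  unfold Omega
  rw [e]
  by_cases hr : r = 0
  · rw [if_pos hr, Finset.card_erase_add_one]
    exact mem_filter.2 ⟨hnil, by simp [hr, blobRank]⟩
  · rw [if_neg hr, Finset.erase_eq_of_notMem, add_zero]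
    intro h
    exact hr (mem_filter.1 h).2.symm

theorem sum_Omega (d n : ℕ) :
    ∑ k ∈ range (n + 1), Omega n k * d ^ k = IW d n n := by
  unfold IW
  rw [← Finset.sum_fiberwise_of_maps_to (s := IMat n n) (t := range (n + 1)) (g := blobRank)]
  · apply Finset.sum_congr rfl
    intro k _
    rw [Omega_eq, Finset.sum_congr rfl (g := fun _ => d ^ k)]
    · simp
    · intro l hl
      rw [(mem_filter.1 hl).2]
  · intro l hl
    rw [mem_IMat] at hl
    have := length_le_of_tops n l (fun p hp => (hl.1 p hp).1) (hl.2.imp (fun h => h.1))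
    have h2 : blobRank l ≤ l.length := List.countP_le_length
    rw [mem_range]; omega

/-! ### Half diagrams -/

/-- Noncrossing half diagrams on `N` points; fixed points are open strands. -/
def HValid (N : ℕ) (f : ℕ → ℕ) : Prop :=
  (∀ x, f (f x) = x) ∧ (∀ x, N ≤ x → f x = x) ∧
  ∀ a b, a < b → b < f a → a < f b ∧ f b < f a ∧ f b ≠ b

/-- the open points -/
def openPts (N : ℕ) (f : ℕ → ℕ) : Finset ℕ := (range N).filter (fun x => f x = x)

/-- last open point -/
def lastOpen (N : ℕ) (f : ℕ → ℕ) : ℕ := (openPts N f).sup id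

/-- match the last open point with `N`. -/
def closeUp (N : ℕ) (f : ℕ → ℕ) : ℕ → ℕ := fun x =>
  if x = N then lastOpen N f else if x = lastOpen N f then N else f x

/-- left exposed arcs -/
def expArcs (N : ℕ) (f : ℕ → ℕ) : Finset ℕ :=
  (range N).filter (fun a => a < f a ∧ ∀ c < a, f c ≠ c ∧ f c < f a)

theorem lastOpen_spec (N : ℕ) (f : ℕ → ℕ) (h : (openPts N f).Nonempty) :
    lastOpen N f < N ∧ f (lastOpen N f) = lastOpen N f ∧
      ∀ x < N, f x = x → x ≤ lastOpen N f := by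
  have h1 : lastOpen N f ∈ openPts N f := by
    obtain ⟨x, hx, he⟩ := Finset.exists_mem_eq_sup (openPts N f) h id
    unfold lastOpen; rw [he]; exact hx
  have h2 := mem_filter.1 h1
  refine ⟨by simpa using h2.1, h2.2, fun x hx hf => ?_⟩
  exact Finset.le_sup (f := id) (b := x) (mem_filter.2 ⟨by simpa using hx, hf⟩)

theorem lastOpen_eq (N p : ℕ) (f : ℕ → ℕ) (h1 : p < N) (h2 : f p = p)
    (h3 : ∀ x < N, f x = x → x ≤ p) : lastOpen N f = p := by
  have hp : p ∈ openPts N f := mem_filter.2 ⟨by simpa using h1, h2⟩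
  have := lastOpen_spec N f ⟨p, hp⟩
  have a := this.2.2 p h1 h2
  have b := h3 _ this.1 this.2.1
  omega

theorem HValid.lt {N : ℕ} {f : ℕ → ℕ} (h : HValid N f) {x : ℕ} (hx : x < N) : f x < N := by
  by_contra hc
  have h1 := h.2.1 (f x) (by omega)
  rw [h.1 x] at h1
  omega

theorem closeUp_facts (N : ℕ) (f : ℕ → ℕ) (h : HValid N f) (ho : (openPts N f).Nonempty) :
    HValid (N + 1) (closeUp N f) ∧
    openPts (N + 1) (closeUp N f) = (openPts N f).erase (lastOpen N f) ∧
    expArcs (N + 1) (closeUp N f) =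
      if (openPts N f).card = 1 then insert (lastOpen N f) (expArcs N f) else expArcs N f := by
  obtain ⟨pN, pf, pmax⟩ := lastOpen_spec N f ho
  set p := lastOpen N f with hp
  have gN : closeUp N f N = p := by simp [closeUp, ← hp]
  have gp : closeUp N f p = N := by simp [closeUp, ← hp, pN.ne]
  have gx : ∀ x, x ≠ N → x ≠ p → closeUp N f x = f x := by
    intro x h1 h2; simp [closeUp, ← hp, h1, h2]
  have fN := h.2.1 N le_rfl
  have fne : ∀ x, x ≠ N → x ≠ p → f x ≠ N ∧ f x ≠ p := by
    intro x h1 h2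
    constructor <;> intro h3
    · have := h.1 x; rw [h3, fN] at this; omega
    · have := h.1 x; rw [h3, pf] at this; omega
  have low : ∀ x, x < p → f x < p := by
    intro x hx
    by_contra hc
    have := (fne x (by omega) (by omega)).2
    exact (h.2.2 x p hx (by omega)).2.2 pf
  have high : ∀ x, p < x → p < f x := by
    intro x hx
    by_contra hc
    have h1 : f x ≠ p := fun h3 => by
      have := h.1 x; rw [h3, pf] at this; omega
    have := low (f x) (by omega)
    rw [h.1] at this; omega
  set g := closeUp N f with hg
  refine ⟨⟨?_, ?_, ?_⟩, ?_, ?_⟩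
  · intro x
    by_cases h1 : x = N
    · subst h1; rw [gN, gp]
    by_cases h2 : x = p
    · rw [h2, gp, gN]
    rw [gx x h1 h2, gx _ (fne x h1 h2).1 (fne x h1 h2).2, h.1]
  · intro x hx
    rw [gx x (by omega) (by omega), h.2.1 x (by omega)]
  · intro a b hab hb
    have haN : a ≤ N := by
      by_contra hc
      rw [gx a (by omega) (by omega), h.2.1 a (by omega)] at hb; omega
    by_cases h1 : a = N
    · subst h1; rw [gN] at hb; omega
    by_cases h2 : a = p
    · subst h2
      rw [gp] at hb ⊢
      rw [gx b (by omega) (by omega)]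
      refine ⟨high b hab, h.lt hb, fun h3 => ?_⟩
      have := pmax b hb h3; omega
    rw [gx a h1 h2] at hb ⊢
    have hl := h.lt (x := a) (by omega)
    have hbp : b ≠ p := by
      rintro rfl
      have := low a hab; omega
    rw [gx b (by omega) hbp]
    exact h.2.2 a b hab hb
  · ext x
    simp only [openPts, mem_filter, mem_range, mem_erase]
    by_cases h1 : x = N
    · subst h1; rw [gN]; omega
    by_cases h2 : x = p
    · subst h2; rw [gp]; omega
    rw [gx x h1 h2]; omega
  · have hcard : (openPts N f).card = 1 ↔ ∀ c < p, f c ≠ c := by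
      have hpm : p ∈ openPts N f := mem_filter.2 ⟨by simpa using pN, pf⟩
      constructor
      · intro h1 c hc hfc
        have hcm : c ∈ openPts N f := mem_filter.2 ⟨by rw [mem_range]; omega, hfc⟩
        have := Finset.card_le_one.1 h1.le c hcm p hpm
        omega
      · intro h1
        rw [Finset.card_eq_one]
        refine ⟨p, ?_⟩
        ext x
        rw [mem_singleton]
        constructor
        · intro hx
          simp only [openPts, mem_filter, mem_range] at hx
          have := pmax x hx.1 hx.2
          by_contra hne
          exact h1 x (by omega) hx.2
        · rintro rfl; exact hpm
    have key : ∀ a, a ∈ expArcs (N + 1) g ↔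
        a ∈ expArcs N f ∨ (a = p ∧ ∀ c < p, f c ≠ c) := by
      intro a
      simp only [expArcs, mem_filter, mem_range]
      rcases lt_trichotomy a p with hlt | rfl | hgt
      · have e : ∀ c ≤ a, g c = f c := fun c hc => gx c (by omega) (by omega)
        rw [e a le_rfl]
        constructor
        · rintro ⟨_, h2, h3⟩
          left
          refine ⟨by omega, h2, fun c hc => ?_⟩
          have := h3 c hc
          rwa [e c hc.le] at this
        · rintro (⟨_, h2, h3⟩ | ⟨h2, _⟩)
          · refine ⟨by omega, h2, fun c hc => ?_⟩
            rw [e c hc.le]; exact h3 c hc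
          · omega
      · rw [gp, pf]
        constructor
        · rintro ⟨_, h2, h3⟩
          right
          refine ⟨rfl, fun c hc => ?_⟩
          have := (h3 c hc).1
          rwa [gx c (by omega) (by omega)] at this
        · rintro (⟨_, h2, h3⟩ | ⟨_, h2⟩)
          · omega
          · refine ⟨by omega, pN, fun c hc => ?_⟩
            rw [gx c (by omega) (by omega)]
            exact ⟨h2 c hc, h.lt (by omega)⟩
      · constructor
        · rintro ⟨h1, h2, h3⟩
          have h4 := (h3 p hgt).2
          rw [gp] at h4
          by_cases h5 : a = N
          · subst h5; rw [gN] at h4; omega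
          · rw [gx a h5 (by omega)] at h4
            have := h.lt (x := a) (by omega)
            omega
        · rintro (⟨_, h2, h3⟩ | ⟨h2, _⟩)
          · exact absurd pf (h3 p hgt).1
          · omega
    ext a
    rw [key]
    split_ifs with hc
    · rw [mem_insert]
      have := hcard.1 hc
      tauto
    · have : ¬ ∀ c < p, f c ≠ c := fun h => hc (hcard.2 h)
      tauto

open Classical in
/-- half diagrams on `N` points with `k` open strands -/
noncomputable def HD : ℕ → ℕ → Finset (ℕ → ℕ)
  | 0, 0 => {id}
  | 0, _ + 1 => ∅
  | N + 1, 0 => (HD N 1).image (closeUp N)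
  | N + 1, k + 1 => HD N k ∪ (HD N (k + 2)).image (closeUp N)

/-- undo the matching of the last point -/
def openUp (N : ℕ) (g : ℕ → ℕ) : ℕ → ℕ := fun x =>
  if x = N then N else if x = g N then g N else g x

theorem openUp_facts (N : ℕ) (g : ℕ → ℕ) (h : HValid (N + 1) g) (hN : g N ≠ N) :
    HValid N (openUp N g) ∧ openPts N (openUp N g) = insert (g N) (openPts (N + 1) g) ∧
    g N ∉ openPts (N + 1) g ∧ closeUp N (openUp N g) = g := by
  have pN : g N < N := by have := h.lt (x := N) (by omega); omega
  have gp : g (g N) = N := h.1 N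
  set p := g N with hp
  have fN : openUp N g N = N := by simp [openUp]
  have fp : openUp N g p = p := by simp [openUp, ← hp, hN]
  have fx : ∀ x, x ≠ N → x ≠ p → openUp N g x = g x := by
    intro x h1 h2; simp [openUp, ← hp, h1, h2]
  have gne : ∀ x, x ≠ N → x ≠ p → g x ≠ N ∧ g x ≠ p := by
    intro x h1 h2
    constructor <;> intro h3
    · have := h.1 x; rw [h3] at this; omega
    · have := h.1 x; rw [h3, gp] at this; omega
  have mid : ∀ x, p < x → x < N → p < g x ∧ g x < N ∧ g x ≠ x := by
    intro x h1 h2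
    have := h.2.2 p x h1 (by omega)
    rwa [gp] at this
  set f := openUp N g with hf
  have last : lastOpen N f = p := by
    apply lastOpen_eq N p f pN fp
    intro x hx hfx
    by_contra hc
    rw [fx x (by omega) (by omega)] at hfx
    exact (mid x (by omega) hx).2.2 hfx
  refine ⟨⟨?_, ?_, ?_⟩, ?_, ?_, ?_⟩
  · intro x
    by_cases h1 : x = N
    · rw [h1, fN, fN]
    by_cases h2 : x = p
    · rw [h2, fp, fp]
    rw [fx x h1 h2, fx _ (gne x h1 h2).1 (gne x h1 h2).2, h.1]
  · intro x hx
    by_cases h1 : x = N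
    · rw [h1, fN]
    rw [fx x h1 (by omega), h.2.1 x (by omega)]
  · intro a b hab hb
    have h1 : a ≠ N := by rintro rfl; rw [fN] at hb; omega
    have h2 : a ≠ p := by rintro rfl; rw [fp] at hb; omega
    rw [fx a h1 h2] at hb ⊢
    have haN : a < N := by
      by_contra hc
      rw [h.2.1 a (by omega)] at hb; omega
    have hgaN : g a < N := by
      have := h.lt (x := a) (by omega)
      have := (gne a h1 h2).1
      omega
    have h3 : b ≠ p := by
      rintro rfl
      have := h.2.2 a p hab hb
      omega
    rw [fx b (by omega) h3]
    exact h.2.2 a b hab hb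
  · ext x
    simp only [openPts, mem_filter, mem_range, mem_insert]
    by_cases h1 : x = N
    · subst h1; rw [fN]; omega
    by_cases h2 : x = p
    · subst h2; rw [fp]; omega
    rw [fx x h1 h2]; omega
  · simp only [openPts, mem_filter, mem_range]
    omega
  · funext x
    unfold closeUp
    rw [last]
    split_ifs with h1 h2
    · rw [h1]
    · rw [h2, gp]
    · exact fx x h1 h2

theorem HValid_succ_fixed (N : ℕ) (g : ℕ → ℕ) :
    (HValid (N + 1) g ∧ g N = N) ↔ HValid N g := by
  constructor
  · rintro ⟨h, hN⟩
    refine ⟨h.1, fun x hx => ?_, h.2.2⟩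
    rcases hx.eq_or_lt with rfl | hx
    · exact hN
    · exact h.2.1 x hx
  · intro h
    exact ⟨⟨h.1, fun x hx => h.2.1 x (by omega), h.2.2⟩, h.2.1 N le_rfl⟩

theorem openPts_succ_fixed (N : ℕ) (g : ℕ → ℕ) (hN : g N = N) :
    (openPts (N + 1) g).card = (openPts N g).card + 1 := by
  unfold openPts
  rw [Finset.range_add_one, Finset.filter_insert, if_pos hN, Finset.card_insert_of_notMem]
  simp

theorem expArcs_succ_fixed (N : ℕ) (g : ℕ → ℕ) (hN : g N = N) :
    expArcs (N + 1) g = expArcs N g := by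
  unfold expArcs
  rw [Finset.range_add_one, Finset.filter_insert, if_neg]
  rw [hN]; omega

theorem openPts_nonempty {N k : ℕ} {f : ℕ → ℕ} (h : (openPts N f).card = k + 1) :
    (openPts N f).Nonempty := by
  rw [← Finset.card_pos]; omega

theorem mem_HD (N : ℕ) : ∀ k f, f ∈ HD N k ↔ HValid N f ∧ (openPts N f).card = k := by
  induction N with
  | zero =>
    intro k f
    have e : (openPts 0 f).card = 0 := by simp [openPts]
    rw [e]
    cases k with
    | zero =>
      simp only [HD, mem_singleton, and_true]
      constructor
      · rintro rfl
        exact ⟨fun _ => rfl, fun _ _ => rfl, fun a b h1 h2 => by simp at h2; omega⟩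
      · intro h; funext x; exact h.2.1 x (by omega)
    | succ k => simp [HD]
  | succ N ih =>
    have closeMem : ∀ k f, f ∈ HD N (k + 1) →
        HValid (N + 1) (closeUp N f) ∧ (openPts (N + 1) (closeUp N f)).card = k := by
      intro k f hf
      rw [ih] at hf
      have ho := openPts_nonempty hf.2
      obtain ⟨h1, h2, _⟩ := closeUp_facts N f hf.1 ho
      refine ⟨h1, ?_⟩
      obtain ⟨pN, pf, _⟩ := lastOpen_spec N f ho
      have hm : lastOpen N f ∈ openPts N f := mem_filter.2 ⟨by simpa using pN, pf⟩
      rw [h2, Finset.card_erase_of_mem hm, hf.2]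
      simp
    have openMem : ∀ k g, HValid (N + 1) g → (openPts (N + 1) g).card = k → g N ≠ N →
        ∃ f ∈ HD N (k + 1), closeUp N f = g := by
      intro k g h1 h2 h3
      obtain ⟨a, b, c, e⟩ := openUp_facts N g h1 h3
      refine ⟨_, ?_, e⟩
      rw [ih, b, Finset.card_insert_of_notMem c, h2]
      exact ⟨a, rfl⟩
    intro k g
    cases k with
    | zero =>
      simp only [HD, mem_image]
      constructor
      · rintro ⟨f, hf, rfl⟩; exact closeMem 0 f hf
      · rintro ⟨h1, h2⟩
        apply openMem 0 g h1 h2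
        intro h3
        have := openPts_succ_fixed N g h3
        omega
    | succ k =>
      simp only [HD, mem_union, mem_image]
      constructor
      · rintro (h | ⟨f, hf, rfl⟩)
        · rw [ih] at h
          have := (HValid_succ_fixed N g).2 h.1
          exact ⟨this.1, by rw [openPts_succ_fixed N g this.2, h.2]⟩
        · exact closeMem (k + 1) f hf
      · rintro ⟨h1, h2⟩
        by_cases h3 : g N = N
        · left
          rw [ih]
          refine ⟨(HValid_succ_fixed N g).1 ⟨h1, h3⟩, ?_⟩
          have := openPts_succ_fixed N g h3
          omega
        · right; exact openMem (k + 1) g h1 h2 h3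

/-- weighted count of half diagrams -/
noncomputable def HW (y N k : ℕ) : ℕ := ∑ f ∈ HD N k, y ^ (expArcs N f).card

theorem closeUp_N (N : ℕ) (f : ℕ → ℕ) : closeUp N f N = lastOpen N f := by simp [closeUp]

theorem closeUp_inj {N k : ℕ} : Set.InjOn (closeUp N) (HD N (k + 1) : Set (ℕ → ℕ)) := by
  intro f hf g hg h
  rw [Finset.mem_coe, mem_HD] at hf hg
  obtain ⟨pN, pf, _⟩ := lastOpen_spec N f (openPts_nonempty hf.2)
  obtain ⟨qN, qf, _⟩ := lastOpen_spec N g (openPts_nonempty hg.2)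
  have e : lastOpen N f = lastOpen N g := by rw [← closeUp_N, ← closeUp_N, h]
  funext x
  have hx := congrFun h x
  by_cases h1 : x = N
  · rw [h1, hf.1.2.1 N le_rfl, hg.1.2.1 N le_rfl]
  by_cases h2 : x = lastOpen N f
  · rw [h2, pf, e, qf]
  · unfold closeUp at hx
    rw [if_neg h1, if_neg h2, if_neg h1, if_neg (e ▸ h2)] at hx
    exact hx

theorem HW_zero_zero (y : ℕ) : HW y 0 0 = 1 := by simp [HW, HD, expArcs]

open Classical in
theorem HW_succ_zero (y N : ℕ) : HW y (N + 1) 0 = y * HW y N 1 := by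
  unfold HW
  rw [HD, Finset.sum_image closeUp_inj, Finset.mul_sum]
  apply Finset.sum_congr rfl
  intro f hf
  rw [mem_HD] at hf
  have ho := openPts_nonempty hf.2
  rw [(closeUp_facts N f hf.1 ho).2.2, if_pos hf.2, Finset.card_insert_of_notMem, pow_succ,
    mul_comm]
  intro hm
  have := (mem_filter.1 hm).2.1
  rw [(lastOpen_spec N f ho).2.1] at this
  omega

open Classical in
theorem HW_succ_succ (y N k : ℕ) : HW y (N + 1) (k + 1) = HW y N k + HW y N (k + 2) := by
  unfold HW
  rw [HD, Finset.sum_union, Finset.sum_image closeUp_inj]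
  · congr 1
    · apply Finset.sum_congr rfl
      intro f hf
      rw [mem_HD] at hf
      rw [expArcs_succ_fixed N f (hf.1.2.1 N le_rfl)]
    · apply Finset.sum_congr rfl
      intro f hf
      rw [mem_HD] at hf
      have ho := openPts_nonempty hf.2
      rw [(closeUp_facts N f hf.1 ho).2.2, if_neg (by omega)]
  · rw [Finset.disjoint_left]
    intro g h1 h2
    rw [mem_image] at h2
    obtain ⟨f, hf, rfl⟩ := h2
    rw [mem_HD] at h1 hf
    have := h1.1.2.1 N le_rfl
    rw [closeUp_N] at this
    have h3 := (lastOpen_spec N f (openPts_nonempty hf.2)).1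
    omega

theorem HW_big (y N : ℕ) : ∀ k, N < k → HW y N k = 0 := by
  induction N with
  | zero =>
    intro k hk
    obtain ⟨k, rfl⟩ : ∃ j, k = j + 1 := ⟨k - 1, by omega⟩
    simp [HW, HD]
  | succ N ih =>
    intro k hk
    obtain ⟨k, rfl⟩ : ∃ j, k = j + 1 := ⟨k - 1, by omega⟩
    rw [HW_succ_succ, ih k (by omega), ih (k + 2) (by omega)]

theorem HW_diag (y N : ℕ) : HW y N N = 1 := by
  induction N with
  | zero => exact HW_zero_zero y
  | succ N ih => rw [HW_succ_succ, ih, HW_big y N (N + 2) (by omega)]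

theorem HW_eq_IW (d n : ℕ) (hn : 1 ≤ n) : HW (d + 1) (2 * n) 0 = IW d n n := by
  obtain ⟨n, rfl⟩ : ∃ j, n = j + 1 := ⟨n - 1, by omega⟩
  have := closed_agree ((d : ℤ) + 1) (fun m j => (HW (d + 1) (m + j) (m - j) : ℤ))
    (fun m j => (IW d m j : ℤ)) ?_ ?_ ?_ ?_ ?_ ?_ n
  · rw [Nat.sub_self, ← two_mul] at this
    exact_mod_cast this
  · intro m; simp [HW_diag]
  · intro m
    rw [Nat.sub_self, show m + 1 + (m + 1) = (m + 1 + m) + 1 by ring, HW_succ_zero,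
      show m + 1 - m = 1 by omega]
    push_cast; ring
  · intro m j hj
    obtain ⟨i, rfl⟩ : ∃ i, m = j + 1 + i := ⟨m - (j + 1), by omega⟩
    rw [show j + 1 + i + 1 - (j + 1) = i + 1 by omega, show j + 1 + i - (j + 1) = i by omega,
      show j + 1 + i + 1 - j = i + 2 by omega,
      show j + 1 + i + 1 + (j + 1) = (j + 1 + i + (j + 1)) + 1 by ring,
      HW_succ_succ, show j + 1 + i + 1 + j = j + 1 + i + (j + 1) by ring]
    push_cast; ring
  · intro m; rw [IW_col_zero]; push_cast; ring
  · intro m; rw [IW_const d (m + 1) m le_rfl]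
  · intro m j hj; rw [IW_rec d m j hj]; push_cast; ring

/-! ### Temperley–Lieb diagrams as half diagrams -/

theorem TLDiagram.ext' {n : ℕ} {D E : TLDiagram n} (h : D.f = E.f) : D = E := by
  cases D; cases E; simp at h; subst h; rfl

/-- extension by the identity -/
def TLDiagram.ext {n : ℕ} (D : TLDiagram n) : ℕ → ℕ := fun x =>
  if h : x < 2 * n then (D.f ⟨x, h⟩ : ℕ) else x

theorem TLDiagram.ext_lt {n : ℕ} (D : TLDiagram n) (x : Fin (2 * n)) :
    D.ext x = D.f x := by
  simp [TLDiagram.ext, x.2]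

theorem TLDiagram.ext_mem {n : ℕ} (D : TLDiagram n) : D.ext ∈ HD (2 * n) 0 := by
  rw [mem_HD]
  have hge : ∀ x, 2 * n ≤ x → D.ext x = x := by
    intro x hx; simp [TLDiagram.ext, not_lt.2 hx]
  refine ⟨⟨?_, hge, ?_⟩, ?_⟩
  · intro x
    by_cases hx : x < 2 * n
    · have := D.ext_lt ⟨x, hx⟩
      simp only at this
      rw [this, D.ext_lt, D.involutive]
    · rw [hge x (by omega), hge x (by omega)]
  · intro a b hab hb
    by_cases ha : a < 2 * n
    swap
    · rw [hge a (by omega)] at hb; omega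
    have ea := D.ext_lt ⟨a, ha⟩
    simp only at ea
    have hfa := (D.f ⟨a, ha⟩).2
    have hb2 : b < 2 * n := by omega
    have eb := D.ext_lt ⟨b, hb2⟩
    simp only at eb
    rw [ea] at hb
    rw [ea, eb]
    have hne : D.f ⟨b, hb2⟩ ≠ D.f ⟨a, ha⟩ := by
      intro h
      have := congrArg D.f h
      rw [D.involutive, D.involutive] at this
      simp at this; omega
    have hne' : D.f ⟨b, hb2⟩ ≠ ⟨a, ha⟩ := by
      intro h
      have := congrArg D.f h
      rw [D.involutive] at this
      rw [← this] at hb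
      simp at hb
    have hnf := D.noFixedPoint ⟨b, hb2⟩
    have c1 := D.noncrossing ⟨a, ha⟩ ⟨b, hb2⟩ hab hb
    have c2 := D.noncrossing (D.f ⟨b, hb2⟩) ⟨a, ha⟩
    rw [D.involutive] at c2
    simp only [Fin.lt_def, ne_eq, Fin.ext_iff] at *
    refine ⟨?_, ?_, hnf⟩
    · by_contra hc
      exact c2 (by omega) hab hb
    · by_contra hc
      exact c1 (by omega)
  · rw [Finset.card_eq_zero, openPts, Finset.filter_eq_empty_iff]
    intro x hx h
    rw [mem_range] at hx
    have := D.ext_lt ⟨x, hx⟩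
    simp only at this
    rw [this] at h
    exact D.noFixedPoint ⟨x, hx⟩ (Fin.ext h)

/-- TL diagrams are the complete half diagrams. -/
noncomputable def tlEquiv (n : ℕ) : TLDiagram n ≃ {f // f ∈ HD (2 * n) 0} :=
  Equiv.ofBijective (fun D => ⟨D.ext, D.ext_mem⟩) (by
    constructor
    · intro D E h
      apply TLDiagram.ext'
      funext x
      have := congrFun (congrArg Subtype.val h) x
      simp only at this
      rw [D.ext_lt, E.ext_lt] at this
      exact Fin.ext this
    · rintro ⟨f, hf⟩
      have hf' := hf
      rw [mem_HD] at hf'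
      obtain ⟨hv, ho⟩ := hf'
      rw [Finset.card_eq_zero, openPts, Finset.filter_eq_empty_iff] at ho
      refine ⟨⟨fun x => ⟨f x, hv.lt x.2⟩, ?_, ?_, ?_⟩, ?_⟩
      · intro x; apply Fin.ext; exact hv.1 x
      · intro x h
        exact ho (mem_range.2 x.2) (congrArg Fin.val h)
      · intro a b h1 h2 h3
        have := hv.2.2 a b h1 h2
        simp only [Fin.lt_def] at h3
        omega
      · apply Subtype.ext
        funext x
        by_cases hx : x < 2 * n
        · simp [TLDiagram.ext, hx]
        · simp [TLDiagram.ext, hx, hv.2.1 x (by omega)])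

theorem exposedCount_eq {n : ℕ} (D : TLDiagram n) :
    exposedCount D = (expArcs (2 * n) D.ext).card := by
  unfold exposedCount
  rw [← Nat.card_eq_finsetCard]
  apply Nat.card_congr
  have key : ∀ a : Fin (2 * n), D.IsExposed a ↔ (a : ℕ) ∈ expArcs (2 * n) D.ext := by
    intro a
    simp only [expArcs, mem_filter, mem_range, TLDiagram.IsExposed]
    rw [D.ext_lt]
    constructor
    · rintro ⟨h1, h2⟩
      refine ⟨a.2, h1, fun c hc => ?_⟩
      have e := D.ext_lt ⟨c, by omega⟩
      simp only at e
      rw [e]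
      refine ⟨fun h => D.noFixedPoint _ (Fin.ext h), ?_⟩
      have h3 := h2 ⟨c, by omega⟩
      by_contra h4
      rcases (not_lt.1 h4).eq_or_lt with h5 | h5
      · have := congrArg D.f (Fin.ext h5)
        rw [D.involutive, D.involutive] at this
        have := congrArg Fin.val this
        simp at this; omega
      · exact h3 ⟨hc, h5⟩
    · rintro ⟨_, h1, h2⟩
      refine ⟨h1, fun c hc => ?_⟩
      have := (h2 c hc.1).2
      rw [D.ext_lt] at this
      have h3 := hc.2
      rw [Fin.lt_def] at h3
      omega
  exact {
    toFun := fun a => ⟨a.1, (key a.1).1 a.2⟩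
    invFun := fun a => ⟨⟨a.1, mem_range.1 (mem_filter.1 a.2).1⟩, (key _).2 a.2⟩
    left_inv := fun a => rfl
    right_inv := fun a => rfl }

instance tlFinite (n : ℕ) : Finite (TLDiagram n) := Finite.of_equiv _ (tlEquiv n).symm

theorem card_arcs {n : ℕ} (D : TLDiagram n) : Nat.card {a // D.IsArc a} = n := by
  classical
  have e : {a // D.IsArc a} ≃ {a // ¬ D.IsArc a} := {
    toFun := fun a => ⟨D.f a.1, by
      have := a.2
      unfold TLDiagram.IsArc at *
      rw [D.involutive]; exact not_lt.2 this.le⟩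
    invFun := fun a => ⟨D.f a.1, by
      have := a.2
      unfold TLDiagram.IsArc at *
      rw [D.involutive]
      exact lt_of_le_of_ne (not_lt.1 this) (D.noFixedPoint _)⟩
    left_inv := fun a => Subtype.ext (D.involutive _)
    right_inv := fun a => Subtype.ext (D.involutive _) }
  have h1 := Nat.card_congr e
  have h2 := Nat.card_congr (Equiv.sumCompl D.IsArc)
  rw [Nat.card_sum, ← h1, Nat.card_fin] at h2
  omega

open Classical in
/-- abacus blob diagrams, fibred over their base -/
noncomputable def abacusEquiv (d n : ℕ) : AbacusBlobDiagram d n ≃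
    Σ D : TLDiagram n, ({a // D.IsArc a} → ZMod d) × ({a // D.IsExposed a} → Option (ZMod d)) where
  toFun A := ⟨A.base, fun a => A.beads₁ a.1,
    fun a => if A.blob a.1 = true then some (A.beads₂ a.1) else none⟩
  invFun B :=
    { base := B.1
      blob := fun a => if h : B.1.IsExposed a then (B.2.2 ⟨a, h⟩).isSome else false
      blob_exposed := by
        intro a h
        by_contra hc
        simp [hc] at h
      beads₁ := fun a => if h : B.1.IsArc a then B.2.1 ⟨a, h⟩ else 0
      beads₂ := fun a => if h : B.1.IsExposed a then (B.2.2 ⟨a, h⟩).getD 0 else 0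
      beads₁_arc := by intro a h; simp [h]
      beads₂_blob := by
        intro a h
        by_cases hc : B.1.IsExposed a
        · simp only [hc, dite_true] at h ⊢
          cases hB : B.2.2 ⟨a, hc⟩ <;> simp_all
        · simp [hc] }
  left_inv := by
    rintro ⟨D, blob, hb, b1, b2, h1, h2⟩
    simp only [AbacusBlobDiagram.mk.injEq, true_and]
    refine ⟨?_, ?_, ?_⟩
    · funext a
      by_cases hc : D.IsExposed a
      · cases h : blob a <;> simp [hc, h]
      · cases h : blob a
        · simp [hc]
        · exact absurd (hb a h) hc
    · funext a
      by_cases hc : D.IsArc a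
      · simp [hc]
      · simp [hc, h1 a hc]
    · funext a
      by_cases hc : D.IsExposed a
      · cases h : blob a
        · simp [hc, h, h2 a h]
        · simp [hc, h]
      · cases h : blob a
        · simp [hc, h2 a h]
        · exact absurd (hb a h) hc
  right_inv := by
    rintro ⟨D, u, v⟩
    simp only [Sigma.mk.injEq, heq_eq_eq, true_and, Prod.mk.injEq]
    refine ⟨?_, ?_⟩
    · funext a; simp [a.2]
    · funext a
      cases h : v a <;> simp [a.2, h]

theorem card_abacus (d n : ℕ) (hd : 1 ≤ d) :
    Nat.card (AbacusBlobDiagram d n) = d ^ n * HW (d + 1) (2 * n) 0 := by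
  have : NeZero d := ⟨by omega⟩
  have := Fintype.ofFinite (TLDiagram n)
  rw [Nat.card_congr (abacusEquiv d n), Nat.card_sigma]
  have e : ∀ D : TLDiagram n, Nat.card (({a // D.IsArc a} → ZMod d) ×
      ({a // D.IsExposed a} → Option (ZMod d))) =
      d ^ n * (d + 1) ^ (expArcs (2 * n) (tlEquiv n D).1).card := by
    intro D
    rw [Nat.card_prod, Nat.card_fun, Nat.card_fun, card_arcs, Finite.card_option, Nat.card_zmod]
    change d ^ n * (d + 1) ^ exposedCount D = _
    rw [exposedCount_eq]; rfl
  rw [Finset.sum_congr rfl (fun D _ => e D), ← Finset.mul_sum]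
  congr 1
  rw [Equiv.sum_comp (tlEquiv n) (fun f => (d + 1) ^ (expArcs (2 * n) f.1).card)]
  unfold HW
  exact Finset.sum_coe_sort (HD (2 * n) 0) (fun f => (d + 1) ^ (expArcs (2 * n) f).card)

/-- the cardinality of the abacus blob monoid `𝔅l_{d,n}` is
`d^n ⬝ Σ_{k=0}^{n} Ω_k^{(n)} d^k`. -/
theorem stmt15 (d n : ℕ) (hd : 1 ≤ d) (hn : 1 ≤ n) :
    Nat.card (AbacusBlobDiagram d n) =
      d ^ n * ∑ k ∈ Finset.range (n + 1), Omega n k * d ^ k := by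
  rw [card_abacus d n hd, HW_eq_IW d n hn, sum_Omega]
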